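/- Let Λ be a ring, M an indecomposable Λ-module of finite length, and T an indecomposable proper submodule of M. Then μ(M) = μ(T) ∪ {|M|} if and only if every proper submodule N of M satisfies μ(N) ≼ μ(T) (i.e., μ(N) = μ(T) or μ(N) ≺ μ(T)). In other words, T ⊂ M is a Gabriel–Roiter inclusion precisely when every proper submodule of M has Gabriel–Roiter measure at most μ(T). -/

import Mathlib

/-- The Gabriel–Roiter total order on sets of natural numbers: `I ≺ J` iff
`I ≠ J` and the least element of the symmetric difference belongs to `J`.
(All sets occurring as Gabriel–Roiter measures consist of positive integers.) -/
def GRlt (I J : Set ℕ) : Prop :=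
  I ≠ J ∧ ∃ m ∈ (I \ J) ∪ (J \ I), (∀ k ∈ (I \ J) ∪ (J \ I), m ≤ k) ∧ m ∈ J

/-- `I ≼ J` iff `I = J` or `I ≺ J`. -/
def GRle (I J : Set ℕ) : Prop := I = J ∨ GRlt I J

/-- A module is indecomposable if it is nonzero and is not the internal direct
sum of two nonzero submodules. -/
def IsIndecomposableModule (Λ : Type*) [Ring Λ] (M : Type*) [AddCommGroup M]
    [Module Λ M] : Prop :=
  (⊤ : Submodule Λ M) ≠ ⊥ ∧
    ¬ ∃ A B : Submodule Λ M, A ≠ ⊥ ∧ B ≠ ⊥ ∧ IsCompl A B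

open Classical in
/-- The (composition series) length `|M|` of a finite length module `M`,
defined via a composition series from `⊥` to `⊤` (any two such have the same
length by the Jordan–Hölder theorem); it is `0` if no such series exists. -/
noncomputable def mlen (Λ : Type*) [Ring Λ] (M : Type*) [AddCommGroup M]
    [Module Λ M] : ℕ :=
  if h : ∃ s : CompositionSeries (Submodule Λ M), s.head = ⊥ ∧ s.last = ⊤ then
    h.choose.length
  else 0

/-- The collection of subsets of `ℕ` of the form `{|M₁|, …, |M_t|}` where
`M₁ ⊂ M₂ ⊂ ⋯ ⊂ M_t` ranges over (finite, nonempty) chains of indecomposable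
submodules of `M`. -/
def grChainSets (Λ : Type*) [Ring Λ] (M : Type*) [AddCommGroup M]
    [Module Λ M] : Set (Set ℕ) :=
  { S | ∃ (t : ℕ) (c : Fin (t + 1) → Submodule Λ M), StrictMono c ∧
      (∀ i, IsIndecomposableModule Λ (c i)) ∧
      S = Set.range fun i => mlen Λ (c i) }

open Classical in
/-- The Gabriel–Roiter measure `μ(M)`: the maximum, with respect to the total
order `≺`, of the sets of lengths of chains of indecomposable submodules of
`M` (and `∅` if this maximum does not exist, e.g. for `M = 0`). -/
noncomputable def grMeasure (Λ : Type*) [Ring Λ] (M : Type*) [AddCommGroup M]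
    [Module Λ M] : Set ℕ :=
  if h : ∃ S, S ∈ grChainSets Λ M ∧ ∀ S' ∈ grChainSets Λ M, GRle S' S then
    h.choose
  else ∅

theorem GRlt_iff_toLex_lt {I J : Set ℕ} :
    GRlt I J ↔ toLex (fun i => i ∈ I) < toLex (fun i => i ∈ J) := by
  constructor
  · rintro ⟨-, m, hm, hmin, hmJ⟩
    refine ⟨m, fun k hk => ?_, ?_⟩
    · by_contra hne
      refine (hmin k ?_).not_gt hk
      simp only [Pi.toLex_apply, eq_iff_iff] at hne
      simp only [Set.mem_union, Set.mem_sdiff]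
      tauto
    · simp only [Set.mem_union, Set.mem_sdiff] at hm
      simp only [Pi.toLex_apply, lt_iff_le_not_ge, le_Prop_eq]
      tauto
  · rintro ⟨m, hk, hm⟩
    simp only [Pi.toLex_apply, eq_iff_iff] at hk
    simp only [Pi.toLex_apply, lt_iff_le_not_ge, le_Prop_eq] at hm
    refine ⟨?_, m, ?_, fun k hmem => ?_, ?_⟩
    · rintro rfl
      tauto
    · simp only [Set.mem_union, Set.mem_sdiff]
      tauto
    · by_contra! hlt
      have := hk k hlt
      simp only [Set.mem_union, Set.mem_sdiff] at hmem
      tauto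
    · tauto

theorem GRle_iff_toLex_le {I J : Set ℕ} :
    GRle I J ↔ toLex (fun i => i ∈ I) ≤ toLex (fun i => i ∈ J) := by
  rw [GRle, GRlt_iff_toLex_lt, le_iff_eq_or_lt]
  refine or_congr_left ⟨fun h => h ▸ rfl, fun h => ?_⟩
  exact Set.ext fun i => iff_of_eq (congrFun (toLex_inj.mp h) i)

theorem GRle.trans {I J K : Set ℕ} (h₁ : GRle I J) (h₂ : GRle J K) : GRle I K :=
  GRle_iff_toLex_le.mpr ((GRle_iff_toLex_le.mp h₁).trans (GRle_iff_toLex_le.mp h₂))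

theorem GRle.antisymm {I J : Set ℕ} (h₁ : GRle I J) (h₂ : GRle J I) : I = J :=
  Set.ext fun i => iff_of_eq <| congrFun (toLex_inj.mp
    ((GRle_iff_toLex_le.mp h₁).antisymm (GRle_iff_toLex_le.mp h₂))) i

theorem GRle_of_subset {I J : Set ℕ} (h : I ⊆ J) : GRle I J :=
  GRle_iff_toLex_le.mpr <| Pi.toLex_monotone fun _ hi => h hi

theorem GRle_insert_insert_iff {m : ℕ} {I J : Set ℕ} (hI : m ∉ I) (hJ : m ∉ J) :
    GRle (insert m I) (insert m J) ↔ GRle I J := by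
  have diff {A B : Set ℕ} (hA : m ∉ A) : insert m A \ insert m B = A \ B := by
    ext k
    simp only [Set.mem_sdiff, Set.mem_insert_iff]
    grind
  have eq : insert m I = insert m J ↔ I = J :=
    ⟨fun h => by rw [← Set.insert_sdiff_self_of_notMem hI, h, Set.insert_sdiff_self_of_notMem hJ],
      fun h => h ▸ rfl⟩
  simp only [GRle, GRlt, diff hI, diff hJ, eq, ne_eq, Set.mem_insert_iff]
  refine or_congr_right <| and_congr_right fun _ => exists_congr fun k => and_congr_right fun hk =>
    and_congr_right fun _ => or_iff_right ?_
  rintro rfl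
  simp [hI, hJ] at hk

theorem exists_GRle_max {C : Set (Set ℕ)} (hC : C.Finite) (hne : C.Nonempty) :
    ∃ S ∈ C, ∀ S' ∈ C, GRle S' S := by
  obtain ⟨S, hS, hmax⟩ := Set.exists_max_image C (fun S => toLex (fun i => i ∈ S)) hC hne
  exact ⟨S, hS, fun S' hS' => GRle_iff_toLex_le.mpr (hmax S' hS')⟩

section Modules

variable {Λ : Type*} [Ring Λ] {M : Type*} [AddCommGroup M] [Module Λ M]
  {M' : Type*} [AddCommGroup M'] [Module Λ M']

theorem mlen_eq_toNat_length : mlen Λ M = (Module.length Λ M).toNat := by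
  unfold mlen
  split_ifs with h
  · rw [← Module.length_compositionSeries _ h.choose_spec.1 h.choose_spec.2, ENat.toNat_natCast]
  · rw [← isFiniteLength_iff_exists_compositionSeries, ← Module.length_ne_top_iff, not_not] at h
    rw [h, ENat.toNat_top]

theorem LinearEquiv.mlen_eq (e : M ≃ₗ[Λ] M') : mlen Λ M = mlen Λ M' := by
  rw [mlen_eq_toNat_length, mlen_eq_toNat_length, e.length_eq]

theorem LinearEquiv.isIndecomposableModule (e : M ≃ₗ[Λ] M') (h : IsIndecomposableModule Λ M) :
    IsIndecomposableModule Λ M' := by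
  let f := (Submodule.orderIsoMapComap e).symm
  refine ⟨fun h' => h.1 (by simpa using congrArg f h'), ?_⟩
  rintro ⟨A, B, hA, hB, hAB⟩
  exact h.2 ⟨f A, f B, (map_eq_bot_iff f).not.mpr hA, (map_eq_bot_iff f).not.mpr hB,
    f.isCompl_iff.mp hAB⟩

theorem mlen_eq_of_eq_top {N : Submodule Λ M} (h : N = ⊤) : mlen Λ N = mlen Λ M :=
  (LinearEquiv.ofTop N h).mlen_eq

theorem mem_grChainSets_submodule_iff {N : Submodule Λ M} {S : Set ℕ} :
    S ∈ grChainSets Λ N ↔ ∃ (t : ℕ) (c : Fin (t + 1) → Submodule Λ M), StrictMono c ∧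
      (∀ i, IsIndecomposableModule Λ (c i)) ∧ (S = Set.range fun i => mlen Λ (c i)) ∧
      c (Fin.last t) ≤ N := by
  constructor
  · rintro ⟨t, c, hc, hi, rfl⟩
    refine ⟨t, fun i => (c i).map N.subtype,
      (Submodule.map_strictMono_of_injective N.injective_subtype).comp hc,
      fun i => (N.equivSubtypeMap (c i)).isIndecomposableModule (hi i), ?_,
      Submodule.map_subtype_le _ _⟩
    simp only [(N.equivSubtypeMap _).mlen_eq]
  · rintro ⟨t, c, hc, hi, rfl, hN⟩
    have hle i : c i ≤ N := (hc.monotone (Fin.le_last i)).trans hN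
    refine ⟨t, fun i => (c i).comap N.subtype, fun i j hij => ?_,
      fun i => (Submodule.comapSubtypeEquivOfLe (hle i)).symm.isIndecomposableModule (hi i), ?_⟩
    · refine (Submodule.comap_mono (hc hij).le).lt_of_not_ge fun h => (hc hij).not_ge ?_
      simpa [Submodule.map_comap_subtype, hle] using Submodule.map_mono (f := N.subtype) h
    · exact congrArg Set.range (funext fun i =>
        (Submodule.comapSubtypeEquivOfLe (hle i)).symm.mlen_eq)

theorem grChainSets_nonempty (h : IsIndecomposableModule Λ M) : (grChainSets Λ M).Nonempty :=
  ⟨_, 0, fun _ => ⊤, Subsingleton.strictMono (α := Fin 1) _,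
    fun _ => Submodule.topEquiv.symm.isIndecomposableModule h, rfl⟩

theorem insert_mlen_mem_grChainSets (h : IsIndecomposableModule Λ M) {N : Submodule Λ M}
    (hN : N ≠ ⊤) {S : Set ℕ} (hS : S ∈ grChainSets Λ N) :
    insert (mlen Λ M) S ∈ grChainSets Λ M := by
  obtain ⟨t, c, hc, hi, rfl, hle⟩ := mem_grChainSets_submodule_iff.mp hS
  refine ⟨t + 1, Fin.snoc (α := fun _ => Submodule Λ M) c ⊤, ?_, fun i => ?_, ?_⟩
  · rw [Fin.strictMono_iff_lt_succ]
    intro i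
    induction i using Fin.lastCases with
    | last => simpa using hle.trans_lt hN.lt_top
    | cast i =>
      rw [Fin.succ_castSucc, Fin.snoc_castSucc, Fin.snoc_castSucc]
      exact hc i.castSucc_lt_succ
  · induction i using Fin.lastCases with
    | last =>
      rw [Fin.snoc_last]
      exact Submodule.topEquiv.symm.isIndecomposableModule h
    | cast i =>
      rw [Fin.snoc_castSucc]
      exact hi i
  · change _ = Set.range ((fun L : Submodule Λ M => mlen Λ L) ∘ _)
    rw [Set.range_comp, Fin.range_snoc, Set.image_insert_eq, mlen_eq_of_eq_top rfl,
      ← Set.range_comp]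
    rfl

theorem exists_subset_insert_mlen {S : Set ℕ} (hS : S ∈ grChainSets Λ M) :
    ∃ S', (S' = ∅ ∨ ∃ N : Submodule Λ M, N ≠ ⊤ ∧ S' ∈ grChainSets Λ N) ∧
      S ⊆ insert (mlen Λ M) S' := by
  obtain ⟨t, c, hc, hi, rfl⟩ := hS
  by_cases htop : c (Fin.last t) = ⊤
  · cases t with
    | zero =>
      refine ⟨∅, Or.inl rfl, ?_⟩
      rintro _ ⟨i, rfl⟩
      exact Or.inl (mlen_eq_of_eq_top (Fin.eq_zero i ▸ htop))
    | succ t =>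
      refine ⟨_, Or.inr ⟨c (Fin.last t).castSucc, ?_, mem_grChainSets_submodule_iff.mpr
        ⟨t, fun i => c i.castSucc, hc.comp Fin.strictMono_castSucc, fun i => hi _, rfl, le_rfl⟩⟩, ?_⟩
      · exact ((hc (Fin.castSucc_lt_last _)).trans_le le_top).ne
      · rintro _ ⟨i, rfl⟩
        induction i using Fin.lastCases with
        | last => exact Or.inl (mlen_eq_of_eq_top htop)
        | cast i => exact Or.inr ⟨i, rfl⟩
  · exact ⟨_, Or.inr ⟨_, htop, mem_grChainSets_submodule_iff.mpr ⟨t, c, hc, hi, rfl, le_rfl⟩⟩,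
      Set.subset_insert _ _⟩

theorem grMeasure_eq_empty_or_mem : grMeasure Λ M = ∅ ∨ grMeasure Λ M ∈ grChainSets Λ M := by
  unfold grMeasure
  split_ifs with h
  · exact Or.inr h.choose_spec.1
  · exact Or.inl rfl

theorem mlen_submodule_lt (hfl : IsFiniteLength Λ M) {N : Submodule Λ M} (hN : N ≠ ⊤) :
    mlen Λ N < mlen Λ M := by
  obtain ⟨_, _⟩ := isFiniteLength_iff_isNoetherian_isArtinian.mp hfl
  rw [mlen_eq_toNat_length, mlen_eq_toNat_length, ← ENat.natCast_lt_natCast,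
    ENat.natCast_toNat Module.length_ne_top, ENat.natCast_toNat Module.length_ne_top]
  exact Submodule.length_lt hN

theorem mlen_submodule_le (hfl : IsFiniteLength Λ M) (N : Submodule Λ M) :
    mlen Λ N ≤ mlen Λ M := by
  obtain rfl | hN := eq_or_ne N ⊤
  · exact (mlen_eq_of_eq_top rfl).le
  · exact (mlen_submodule_lt hfl hN).le

theorem IsFiniteLength.submodule (hfl : IsFiniteLength Λ M) (N : Submodule Λ M) :
    IsFiniteLength Λ N :=
  hfl.of_injective N.injective_subtype

theorem finite_grChainSets (hfl : IsFiniteLength Λ M) : (grChainSets Λ M).Finite := by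
  refine (Set.finite_Iic (mlen Λ M)).finite_subsets.subset ?_
  rintro _ ⟨t, c, -, -, rfl⟩ _ ⟨i, rfl⟩
  exact mlen_submodule_le hfl _

theorem grMeasure_isGreatest (hfl : IsFiniteLength Λ M) (hne : (grChainSets Λ M).Nonempty) :
    grMeasure Λ M ∈ grChainSets Λ M ∧ ∀ S ∈ grChainSets Λ M, GRle S (grMeasure Λ M) := by
  have h := exists_GRle_max (finite_grChainSets hfl) hne
  rw [grMeasure, dif_pos h]
  exact h.choose_spec

theorem GRle_grMeasure (hfl : IsFiniteLength Λ M) {S : Set ℕ} (hS : S ∈ grChainSets Λ M) :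
    GRle S (grMeasure Λ M) :=
  (grMeasure_isGreatest hfl ⟨S, hS⟩).2 S hS

theorem mlen_notMem_of_mem_grChainSets (hfl : IsFiniteLength Λ M) {N : Submodule Λ M}
    (hN : N ≠ ⊤) {S : Set ℕ} (hS : S ∈ grChainSets Λ N) : mlen Λ M ∉ S := by
  obtain ⟨t, c, -, -, rfl⟩ := hS
  rintro ⟨i, hi⟩
  exact ((mlen_submodule_le (hfl.submodule N) (c i)).trans_lt (mlen_submodule_lt hfl hN)).ne hi

end Modules

/-- Let `Λ` be a ring, `M` an indecomposable `Λ`-module of finite length, and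
`T` an indecomposable proper submodule of `M`.  Then `μ(M) = μ(T) ∪ {|M|}` if
and only if every proper submodule `N` of `M` satisfies `μ(N) ≼ μ(T)`.
That is, `T ⊂ M` is a Gabriel–Roiter inclusion precisely when every proper
submodule of `M` has Gabriel–Roiter measure at most `μ(T)`. -/
theorem gr_inclusion_iff (Λ : Type*) [Ring Λ] (M : Type*) [AddCommGroup M]
    [Module Λ M] (hfl : IsFiniteLength Λ M)
    (hind : IsIndecomposableModule Λ M)
    (T : Submodule Λ M) (hT : T ≠ ⊤) (hTind : IsIndecomposableModule Λ T) :
    grMeasure Λ M = grMeasure Λ T ∪ {mlen Λ M} ↔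
      ∀ N : Submodule Λ M, N ≠ ⊤ → GRle (grMeasure Λ N) (grMeasure Λ T) := by
  have hTmem := (grMeasure_isGreatest (hfl.submodule T) (grChainSets_nonempty hTind)).1
  have hTnot := mlen_notMem_of_mem_grChainSets hfl hT hTmem
  rw [Set.union_singleton]
  constructor
  · intro hM N hN
    obtain h | h := grMeasure_eq_empty_or_mem (Λ := Λ) (M := N)
    · exact h ▸ GRle_of_subset (Set.empty_subset _)
    · rw [← GRle_insert_insert_iff (mlen_notMem_of_mem_grChainSets hfl hN h) hTnot, ← hM]
      exact GRle_grMeasure hfl (insert_mlen_mem_grChainSets hind hN h)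
  · intro h
    refine GRle.antisymm ?_ (GRle_grMeasure hfl (insert_mlen_mem_grChainSets hind hT hTmem))
    obtain ⟨S, hS, hsub⟩ := exists_subset_insert_mlen
      (grMeasure_isGreatest hfl (grChainSets_nonempty hind)).1
    refine (GRle_of_subset hsub).trans ?_
    obtain rfl | ⟨N, hN, hS⟩ := hS
    · exact GRle_of_subset (Set.insert_subset_insert (Set.empty_subset _))
    · rw [GRle_insert_insert_iff (mlen_notMem_of_mem_grChainSets hfl hN hS) hTnot]
      exact (GRle_grMeasure (hfl.submodule N) hS).trans (h N hN)
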